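/- Let k and ℓ be integers with k, ℓ ≥ 2 and 2k ≥ ℓ. Then C(C_{2k}, C_ℓ) = 4k(k−1)/(2kℓ−2k−ℓ). -/

import Mathlib

open SimpleGraph

/-- The homomorphism density `t(G,T)`. -/
noncomputable def homDensity {α β : Type*} [Fintype α] [Fintype β]
    (G : SimpleGraph α) (T : SimpleGraph β) : ℝ :=
  (Nat.card (G →g T) : ℝ) / (Fintype.card β : ℝ) ^ (Fintype.card α)
/-- The set of real exponents `c ≥ 0` such that `t(G,T) ≥ t(H,T)^c` for all
finite graphs `T` with at least one vertex. -/
def domSet {α β : Type*} [Fintype α] [Fintype β]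
    (G : SimpleGraph α) (H : SimpleGraph β) : Set ℝ :=
  {c : ℝ | 0 ≤ c ∧ ∀ (n : ℕ), 0 < n → ∀ T : SimpleGraph (Fin n),
    homDensity H T ^ c ≤ homDensity G T}

/-- The homomorphism density domination exponent `C(G,H)`, as the infimum of `domSet G H`. -/
noncomputable def domExp {α β : Type*} [Fintype α] [Fintype β]
    (G : SimpleGraph α) (H : SimpleGraph β) : ℝ :=
  sInf (domSet G H)


lemma matrix_pow_succ_apply_eq_sum {V : Type*} [Fintype V] [DecidableEq V] (A : Matrix V V ℝ)
    (m : ℕ) (u v : V) :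
    (A ^ (m+1)) u v = ∑ f : Fin m → V, ∏ i : Fin (m+1),
      A ((Fin.cons u f : Fin (m+1) → V) i) ((Fin.snoc f v : Fin (m+1) → V) i) := by
  induction m generalizing u with
  | zero => simp [Fin.snoc]
  | succ m ih =>
    rw [pow_succ', Matrix.mul_apply]
    rw [← (Fin.consEquiv (fun _ : Fin (m+1) => V)).sum_comp, Fintype.sum_prod_type]
    refine Finset.sum_congr rfl fun w _ => ?_
    rw [ih, Finset.mul_sum]
    refine Finset.sum_congr rfl fun f _ => ?_
    rw [Fin.prod_univ_succ (n := m+1)]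
    simp only [Fin.consEquiv, Equiv.coe_fn_mk, ← Fin.cons_snoc_eq_snoc_cons, Fin.cons_zero,
      Fin.cons_succ]

lemma snoc_eq_rotate {V : Type*} (m : ℕ) (u : V) (f : Fin m → V) (i : Fin (m+1)) :
    (Fin.snoc f u : Fin (m+1) → V) i = (Fin.cons u f : Fin (m+1) → V) (i + 1) := by
  refine Fin.lastCases ?_ (fun j => ?_) i
  · simp
  · simp

lemma trace_pow_eq_sum {V : Type*} [Fintype V] [DecidableEq V] (A : Matrix V V ℝ) (m : ℕ) :
    (A ^ (m+1)).trace = ∑ f : Fin (m+1) → V, ∏ i : Fin (m+1), A (f i) (f (i+1)) := by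
  rw [← (Fin.consEquiv (fun _ : Fin (m+1) => V)).sum_comp, Fintype.sum_prod_type]
  refine Finset.sum_congr rfl fun u _ => ?_
  rw [Matrix.diag_apply, matrix_pow_succ_apply_eq_sum]
  refine Finset.sum_congr rfl fun f _ => Finset.prod_congr rfl fun i _ => ?_
  rw [snoc_eq_rotate]
  rfl

/-- Homomorphisms from a cycle are cyclic sequences of adjacent vertices. -/
def cycleHomEquiv {V : Type*} (T : SimpleGraph V) (m : ℕ) :
    (cycleGraph (m+2) →g T) ≃ {f : Fin (m+2) → V // ∀ i, T.Adj (f i) (f (i+1))} where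
  toFun φ := ⟨φ, fun i => φ.map_rel (by
    show (cycleGraph (m+2)).Adj i (i+1)
    rw [cycleGraph_adj]; right; simp)⟩
  invFun f := ⟨f.1, by
    intro a b h
    rw [cycleGraph_adj] at h
    rcases h with h | h
    · have := f.2 b
      rw [show b + 1 = a by rw [← h]; abel] at this
      exact this.symm
    · have := f.2 a
      rw [show a + 1 = b by rw [← h]; abel] at this
      exact this⟩
  left_inv φ := rfl
  right_inv f := rfl

lemma card_cycle_hom_eq_trace {V : Type*} [Fintype V] [DecidableEq V] (T : SimpleGraph V)
    [DecidableRel T.Adj] (m : ℕ) (hm : 2 ≤ m) :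
    (Nat.card (cycleGraph m →g T) : ℝ) = ((T.adjMatrix ℝ) ^ m).trace := by
  obtain ⟨m, rfl⟩ := Nat.exists_eq_add_of_le' hm
  rw [Nat.card_congr (cycleHomEquiv T m), trace_pow_eq_sum _ (m+1)]
  have h : ∀ f : Fin (m+1+1) → V, ∏ i, T.adjMatrix ℝ (f i) (f (i+1)) =
      if (∀ i, T.Adj (f i) (f (i+1))) then 1 else 0 := by
    intro f
    simp only [adjMatrix_apply]
    rw [Finset.prod_ite_zero]
    simp
  simp_rw [h]
  rw [Finset.sum_boole, Nat.card_eq_fintype_card, Fintype.card_subtype]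

lemma trace_pow_eq_sum_eigenvalues {V : Type*} [Fintype V] [DecidableEq V] {A : Matrix V V ℝ}
    (hA : A.IsHermitian) (m : ℕ) :
    (A ^ m).trace = ∑ i, hA.eigenvalues i ^ m := by
  conv_lhs => rw [hA.spectral_theorem, ← map_pow, Unitary.conjStarAlgAut_apply,
    Matrix.trace_mul_comm, ← mul_assoc]
  simp [Matrix.diagonal_pow, Matrix.trace]

lemma rayleigh_pow {V : Type*} [Fintype V] [DecidableEq V] [Nonempty V] {A : Matrix V V ℝ}
    (hA : A.IsHermitian) (k : ℕ) :
    ((∑ u, ∑ v, A u v) / (Fintype.card V : ℝ)) ^ (2*k) ≤ ∑ i, hA.eigenvalues i ^ (2*k) := by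
  have hn : (0:ℝ) < Fintype.card V := by exact_mod_cast Fintype.card_pos
  set U : Matrix V V ℝ := (hA.eigenvectorUnitary : Matrix V V ℝ) with hU
  have hUU : U * star U = 1 := by simp [hU]
  set w : V → ℝ := fun i => ∑ u, U u i with hw
  have hws : ∑ i, w i ^ 2 = Fintype.card V := by
    have : ∀ i, w i ^ 2 = ∑ u, ∑ v, U u i * (star U) i v := by
      intro i
      rw [sq, hw, Finset.sum_mul_sum]
      simp [Matrix.star_apply]
    simp_rw [this]
    rw [Finset.sum_comm]
    simp_rw [fun u => Finset.sum_comm (s := (Finset.univ : Finset V)) (t := (Finset.univ : Finset V))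
      (f := fun i v => U u i * (star U) i v), ← Matrix.mul_apply, hUU]
    simp [Matrix.one_apply]
  have hAe : ∀ u v, A u v = ∑ i, U u i * hA.eigenvalues i * U v i := by
    intro u v
    conv_lhs => rw [hA.spectral_theorem, Unitary.conjStarAlgAut_apply, Matrix.mul_apply]
    simp [Matrix.mul_diagonal, Matrix.star_apply, hU]
  have hsum : ∑ u, ∑ v, A u v = ∑ i, w i ^ 2 * hA.eigenvalues i := by
    simp_rw [hAe]
    simp_rw [fun u => Finset.sum_comm (s := (Finset.univ : Finset V)) (t := (Finset.univ : Finset V))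
      (f := fun v i => U u i * hA.eigenvalues i * U v i)]
    rw [Finset.sum_comm]
    refine Finset.sum_congr rfl fun i _ => ?_
    rw [sq, hw, Finset.sum_mul_sum, Finset.sum_mul]
    refine Finset.sum_congr rfl fun u _ => ?_
    rw [Finset.sum_mul]
    refine Finset.sum_congr rfl fun v _ => ?_
    ring
  have hJ := Real.pow_arith_mean_le_arith_mean_pow_of_even Finset.univ
    (fun i => w i ^ 2 / (Fintype.card V : ℝ)) hA.eigenvalues (fun i _ => by positivity)
    (by rw [← Finset.sum_div, hws, div_self hn.ne']) (even_two_mul k)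
  have he : (∑ u, ∑ v, A u v) / (Fintype.card V : ℝ) =
      ∑ i, w i ^ 2 / (Fintype.card V : ℝ) * hA.eigenvalues i := by
    rw [hsum, Finset.sum_div]
    exact Finset.sum_congr rfl fun i _ => by ring
  rw [he]
  refine hJ.trans (Finset.sum_le_sum fun i _ => ?_)
  refine mul_le_of_le_one_left ((even_two_mul k).pow_nonneg _) ?_
  rw [div_le_one hn, ← hws]
  exact Finset.single_le_sum (f := fun i => w i ^ 2) (fun j _ => sq_nonneg _) (Finset.mem_univ i)

/-- The interpolation inequality. -/
lemma interpolation {ι : Type*} [Fintype ι] (x : ι → ℝ) (k l : ℕ) (hk : 2 ≤ k) (hl : 2 ≤ l)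
    (hkl : l ≤ 2*k) (h : (∑ i, x i ^ 2) ^ (2*k) ≤ ∑ i, x i ^ (2*k)) (hpos : 0 ≤ ∑ i, x i ^ l) :
    (∑ i, x i ^ l) ^ ((4*(k:ℝ)*((k:ℝ)-1)) / (2*(k:ℝ)*(l:ℝ) - 2*(k:ℝ) - (l:ℝ))) ≤
      ∑ i, x i ^ (2*k) := by
  have hkR : (2:ℝ) ≤ k := by exact_mod_cast hk
  have hlR : (2:ℝ) ≤ l := by exact_mod_cast hl
  have hklR : (l:ℝ) ≤ 2*k := by exact_mod_cast hkl
  have hE : 0 < 2*(k:ℝ)*(l:ℝ) - 2*(k:ℝ) - (l:ℝ) := by nlinarith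
  have hD : 0 < 4*(k:ℝ)*((k:ℝ)-1) := by nlinarith
  set c := (4*(k:ℝ)*((k:ℝ)-1)) / (2*(k:ℝ)*(l:ℝ) - 2*(k:ℝ) - (l:ℝ)) with hc
  have hcpos : 0 < c := div_pos hD hE
  set Q := ∑ i, x i ^ (2*k) with hQ
  have hQ0 : 0 ≤ Q := Finset.sum_nonneg fun i _ => (even_two_mul k).pow_nonneg _
  rcases hQ0.eq_or_lt with hz | hQpos
  · have hx : ∀ i, x i = 0 := by
      intro i
      have := (Finset.sum_eq_zero_iff_of_nonneg
        (fun i _ => (even_two_mul k).pow_nonneg (x i))).1 hz.symm i (Finset.mem_univ i)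
      exact pow_eq_zero_iff (by omega) |>.1 this
    have : ∑ i, x i ^ l = 0 := by
      refine Finset.sum_eq_zero fun i _ => ?_
      rw [hx i, zero_pow (by omega)]
    rw [this, Real.zero_rpow hcpos.ne']
    exact hQ0
  set θ : ℝ := (2*k - l) / (2*(k-1)) with hθ
  have h2k : (0:ℝ) < 2*(k-1) := by linarith
  have hk1 : (k:ℝ) - 1 ≠ 0 := by linarith
  have h2k' := h2k.ne'
  have hθ0 : 0 ≤ θ := div_nonneg (by linarith) h2k.le
  have hθ1 : 0 ≤ 1 - θ := by
    have : 1 - θ = (l-2)/(2*(k-1)) := by rw [hθ]; field_simp; ring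
    rw [this]; exact div_nonneg (by linarith) h2k.le
  have hθl : 2*θ + 2*k*(1-θ) = l := by rw [hθ]; field_simp; ring
  set α := Q ^ ((1:ℝ)/(2*k)) with hα
  have hαpos : 0 < α := Real.rpow_pos_of_pos hQpos _
  have hPα : ∑ i, x i ^ 2 ≤ α := by
    have hP0 : 0 ≤ ∑ i, x i ^ 2 := Finset.sum_nonneg fun i _ => sq_nonneg _
    refine le_of_pow_le_pow_left₀ (n := 2*k) (by omega) hαpos.le ?_
    refine h.trans (le_of_eq ?_)
    rw [hα, ← Real.rpow_natCast, ← Real.rpow_mul hQ0]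
    push_cast
    rw [div_mul_cancel₀ _ (by positivity), Real.rpow_one]
  have key : ∀ i, x i ^ l ≤ α ^ θ * Q ^ (1-θ) * (θ * (x i ^ 2 / α) + (1-θ) * (x i ^ (2*k) / Q)) := by
    intro i
    have h1 : x i ^ l ≤ |x i| ^ l := by rw [← abs_pow]; exact le_abs_self _
    have hx2 : 0 ≤ x i ^ 2 := sq_nonneg _
    have hx2k : 0 ≤ x i ^ (2*k) := (even_two_mul k).pow_nonneg _
    have h2 : |x i| ^ l = (x i ^ 2) ^ θ * (x i ^ (2*k)) ^ (1-θ) := by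
      rw [← sq_abs, ← (even_two_mul k).pow_abs, ← Real.rpow_natCast, ← Real.rpow_natCast,
        ← Real.rpow_natCast, ← Real.rpow_mul (abs_nonneg _), ← Real.rpow_mul (abs_nonneg _),
        ← Real.rpow_add_of_nonneg (abs_nonneg _) (by positivity) (by positivity)]
      congr 1
      push_cast
      exact hθl.symm
    have h3 := Real.geom_mean_le_arith_mean2_weighted hθ0 hθ1 (div_nonneg hx2 hαpos.le)
      (div_nonneg hx2k hQ0) (by ring)
    have h4 : (x i ^ 2) ^ θ * (x i ^ (2*k)) ^ (1-θ) =
        α ^ θ * Q ^ (1-θ) * ((x i ^ 2 / α) ^ θ * (x i ^ (2*k) / Q) ^ (1-θ)) := by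
      rw [Real.div_rpow hx2 hαpos.le, Real.div_rpow hx2k hQ0]
      have : 0 < α ^ θ := Real.rpow_pos_of_pos hαpos _
      have : 0 < Q ^ (1-θ) := Real.rpow_pos_of_pos hQpos _
      field_simp
    rw [h2, h4] at h1
    refine h1.trans (mul_le_mul_of_nonneg_left h3 (by positivity))
  have hsum : ∑ i, x i ^ l ≤ α ^ θ * Q ^ (1-θ) := by
    calc ∑ i, x i ^ l ≤ ∑ i, α ^ θ * Q ^ (1-θ) *
          (θ * (x i ^ 2 / α) + (1-θ) * (x i ^ (2*k) / Q)) := Finset.sum_le_sum fun i _ => key i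
      _ = α ^ θ * Q ^ (1-θ) * (θ * ((∑ i, x i ^ 2) / α) + (1-θ) * (Q / Q)) := by
          rw [← Finset.mul_sum, Finset.sum_add_distrib, ← Finset.mul_sum, ← Finset.mul_sum,
            ← Finset.sum_div, ← Finset.sum_div]
      _ ≤ α ^ θ * Q ^ (1-θ) * (θ * 1 + (1-θ) * 1) := by
          have h1 : (∑ i, x i ^ 2) / α ≤ 1 := (div_le_one hαpos).2 hPα
          have h2 : Q / Q ≤ 1 := div_self_le_one Q
          gcongr
      _ = α ^ θ * Q ^ (1-θ) := by ring
  have hfin : α ^ θ * Q ^ (1-θ) = Q ^ (1/c) := by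
    rw [hα, ← Real.rpow_mul hQ0, ← Real.rpow_add hQpos]
    congr 1
    rw [hc, hθ]
    have : (k:ℝ) ≠ 0 := by positivity
    have : (k:ℝ) - 1 ≠ 0 := by linarith
    have := hE.ne'
    have := h2k.ne'
    rw [one_div_div]
    field_simp
    ring
  rw [hfin] at hsum
  calc (∑ i, x i ^ l) ^ c ≤ (Q ^ (1/c)) ^ c := Real.rpow_le_rpow hpos hsum hcpos.le
    _ = Q := by rw [← Real.rpow_mul hQ0, one_div_mul_cancel hcpos.ne', Real.rpow_one]

lemma upper_mem (k l : ℕ) (hk : 2 ≤ k) (hl : 2 ≤ l) (hkl : l ≤ 2*k) :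
    (4*(k:ℝ)*((k:ℝ)-1)) / (2*(k:ℝ)*(l:ℝ) - 2*(k:ℝ) - (l:ℝ)) ∈
      domSet (cycleGraph (2*k)) (cycleGraph l) := by
  have hkR : (2:ℝ) ≤ k := by exact_mod_cast hk
  have hlR : (2:ℝ) ≤ l := by exact_mod_cast hl
  refine ⟨div_nonneg (by nlinarith) (by nlinarith), ?_⟩
  intro n hn T
  classical
  have : Nonempty (Fin n) := ⟨⟨0, hn⟩⟩
  have hA : (T.adjMatrix ℝ).IsHermitian := by
    rw [Matrix.IsHermitian, Matrix.conjTranspose_eq_transpose_of_trivial, transpose_adjMatrix]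
  have hnR : (0:ℝ) < n := by exact_mod_cast hn
  have hd : ∀ m, 2 ≤ m → homDensity (cycleGraph m) T = ∑ i, (hA.eigenvalues i / n) ^ m := by
    intro m hm
    rw [homDensity, card_cycle_hom_eq_trace T m hm, trace_pow_eq_sum_eigenvalues hA]
    simp [div_pow, Finset.sum_div]
  have hpos : 0 ≤ homDensity (cycleGraph l) T := by unfold homDensity; positivity
  rw [hd l hl] at hpos ⊢
  rw [hd (2*k) (by omega)]
  refine interpolation _ k l hk hl hkl ?_ hpos
  have hR := rayleigh_pow hA k
  have h2 : ∑ u, ∑ v, T.adjMatrix ℝ u v = ∑ i, hA.eigenvalues i ^ 2 := by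
    rw [← trace_pow_eq_sum_eigenvalues hA, sq, Matrix.trace]
    refine Finset.sum_congr rfl fun u _ => ?_
    rw [Matrix.diag_apply, Matrix.mul_apply]
    refine Finset.sum_congr rfl fun v _ => ?_
    simp [adjMatrix_apply, T.adj_comm v u]
  rw [h2] at hR
  simp only [Fintype.card_fin] at hR
  simp_rw [div_pow]
  rw [← Finset.sum_div, ← Finset.sum_div]
  have : ((∑ i, hA.eigenvalues i ^ 2) / (n:ℝ)^2) ^ (2*k) =
    ((∑ i, hA.eigenvalues i ^ 2) / n) ^ (2*k) / n ^ (2*k) := by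
    rw [← div_pow, div_div, sq]
  rw [this]
  gcongr

/-- The Cayley graph on `F^d` whose connection set is the cone over the moment curve. -/
def momGraph (F : Type*) [Field F] (d : ℕ) : SimpleGraph (Fin d → F) where
  Adj x y := x ≠ y ∧ ∃ t a : F, ∀ j : Fin d, y j - x j = a * t ^ (j:ℕ)
  symm := ⟨by
    rintro x y ⟨h, t, a, hta⟩
    refine ⟨h.symm, t, -a, fun j => ?_⟩
    rw [neg_mul, ← hta j]; ring⟩
  loopless := ⟨fun x h => h.1 rfl⟩

lemma class_sum_zero {F : Type*} [Field F] [DecidableEq F] {m : ℕ} (t a : Fin m → F)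
    (h : ∀ j : Fin m, ∑ i, a i * t i ^ (j:ℕ) = 0) (i₀ : Fin m) :
    ∑ i, (if t i = t i₀ then a i else 0) = 0 := by
  set P : Polynomial F := ∏ s ∈ (Finset.univ.image t).erase (t i₀), (Polynomial.X - Polynomial.C s)
    with hP
  have hdeg : P.natDegree < m := by
    rw [hP, Polynomial.natDegree_finsetProd_X_sub_C_eq_card]
    calc _ < (Finset.univ.image t).card :=
          Finset.card_erase_lt_of_mem (Finset.mem_image_of_mem _ (Finset.mem_univ _))
      _ ≤ (Finset.univ : Finset (Fin m)).card := Finset.card_image_le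
      _ = m := by simp
  have hsum : ∑ i, a i * P.eval (t i) = 0 := by
    simp_rw [Polynomial.eval_eq_sum_range' hdeg, Finset.mul_sum]
    rw [Finset.sum_comm]
    refine Finset.sum_eq_zero fun j hj => ?_
    have := h ⟨j, Finset.mem_range.1 hj⟩
    simp only at this
    calc ∑ i, a i * (P.coeff j * t i ^ j) = P.coeff j * ∑ i, a i * t i ^ j := by
          rw [Finset.mul_sum]; exact Finset.sum_congr rfl fun i _ => by ring
      _ = 0 := by rw [this, mul_zero]
  have hne : P.eval (t i₀) ≠ 0 := by
    rw [hP, Polynomial.eval_prod, Finset.prod_ne_zero_iff]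
    intro s hs
    simp only [Polynomial.eval_sub, Polynomial.eval_X, Polynomial.eval_C]
    exact sub_ne_zero.2 (Finset.ne_of_mem_erase hs).symm
  have hz : ∀ i, a i * P.eval (t i) = (if t i = t i₀ then a i else 0) * P.eval (t i₀) := by
    intro i
    split_ifs with hi
    · rw [hi]
    · have : P.eval (t i) = 0 := by
        rw [hP, Polynomial.eval_prod]
        refine Finset.prod_eq_zero (i := t i) ?_ (by simp)
        exact Finset.mem_erase.2 ⟨hi, Finset.mem_image_of_mem _ (Finset.mem_univ _)⟩
      rw [this]; simp
  simp_rw [hz] at hsum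
  rw [← Finset.sum_mul] at hsum
  exact (mul_eq_zero.1 hsum).resolve_right hne

/-- Solutions of the moment system. -/
def MomSol (F : Type*) [Field F] (m : ℕ) : Type _ :=
  {p : (Fin m → F) × (Fin m → F) // ∀ j : Fin m, ∑ i, p.2 i * p.1 i ^ (j:ℕ) = 0}

instance (F : Type*) [Field F] [Finite F] (m : ℕ) : Finite (MomSol F m) := by
  unfold MomSol; infer_instance

lemma card_momSol_le (F : Type*) [Field F] [Fintype F] (m : ℕ) (hm : 0 < m) :
    Nat.card (MomSol F m) ≤ m ^ m * Fintype.card F ^ m := by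
  classical
  have : Nonempty (Fin m) := ⟨⟨0, hm⟩⟩
  let r : (Fin m → F) → Fin m → Fin m := fun t i => Function.invFun t (t i)
  have hr : ∀ (t : Fin m → F) i, t (r t i) = t i := fun t i => Function.invFun_eq ⟨i, rfl⟩
  have hrr : ∀ (t : Fin m → F) i, r t (r t i) = r t i := fun t i => by
    show Function.invFun t (t (r t i)) = _
    rw [hr t i]
  let g : MomSol F m → (Fin m → Fin m) × (Fin m → F) := fun p =>
    (r p.1.1, fun i => if r p.1.1 i = i then p.1.1 i else p.1.2 i)
  have hg : Function.Injective g := by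
    rintro ⟨⟨t, a⟩, h⟩ ⟨⟨t', a'⟩, h'⟩ heq
    simp only [g, Prod.mk.injEq] at heq
    obtain ⟨h1, h2⟩ := heq
    simp only at h h'
    have ht : t = t' := by
      funext i
      have := congrFun h2 (r t i)
      rw [← h1] at this
      simp only [hrr, if_true] at this
      rw [hr t i] at this
      rw [this, h1, hr t' i]
    subst ht
    have ha : a = a' := by
      have hnon : ∀ i, r t i ≠ i → a i = a' i := by
        intro i hi
        have := congrFun h2 i
        simpa [hi] using this
      funext i
      by_cases hi : r t i = i
      · have e1 := class_sum_zero t a h i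
        have e2 := class_sum_zero t a' h' i
        have e3 : ∑ j, (if t j = t i then a j - a' j else 0) = 0 := by
          have e4 : (∑ j, (if t j = t i then a j else 0)) -
              ∑ j, (if t j = t i then a' j else 0) = 0 := by rw [e1, e2, sub_zero]
          refine Eq.trans ?_ e4
          rw [← Finset.sum_sub_distrib]
          refine Finset.sum_congr rfl fun j _ => ?_
          split_ifs <;> simp
        rw [Finset.sum_eq_single i] at e3
        · simpa [sub_eq_zero] using e3
        · intro j _ hj
          split_ifs with htj
          · rw [hnon j, sub_self]
            intro hjj
            apply hj
            rw [← hjj, ← hi]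
            show Function.invFun t (t j) = Function.invFun t (t i)
            rw [htj]
          · rfl
        · simp
      · exact hnon i hi
    subst ha
    rfl
  calc Nat.card (MomSol F m) ≤ Nat.card ((Fin m → Fin m) × (Fin m → F)) :=
        Nat.card_le_card_of_injective g hg
    _ = _ := by simp

lemma card_hom_le (F : Type*) [Field F] [Fintype F] (m : ℕ) (hm : 2 ≤ m) :
    Nat.card (cycleGraph m →g momGraph F m) ≤
      Fintype.card F ^ m * (m ^ m * Fintype.card F ^ m) := by
  obtain ⟨m, rfl⟩ := Nat.exists_eq_add_of_le' hm
  rw [Nat.card_congr (cycleHomEquiv _ m)]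
  have hex : ∀ f : {f : Fin (m+2) → (Fin (m+2) → F) //
      ∀ i, (momGraph F (m+2)).Adj (f i) (f (i+1))}, ∃ s : MomSol F (m+2),
      ∀ i j, f.1 (i+1) j - f.1 i j = s.1.2 i * s.1.1 i ^ (j:ℕ) := by
    rintro ⟨f, hf⟩
    have hf' := fun i => (hf i).2
    choose t a hta using hf'
    refine ⟨⟨(t, a), fun j => ?_⟩, hta⟩
    simp_rw [← hta]
    rw [Finset.sum_sub_distrib, sub_eq_zero]
    exact Equiv.sum_comp (Equiv.addRight (1 : Fin (m+2))) (fun i => f i j)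
  choose s hs using hex
  calc _ ≤ Nat.card ((Fin (m+2) → F) × MomSol F (m+2)) := by
        refine Nat.card_le_card_of_injective (fun f => (f.1 0, s f)) ?_
        intro f g hfg
        simp only [Prod.mk.injEq] at hfg
        obtain ⟨h0, h1⟩ := hfg
        apply Subtype.ext
        funext i
        induction i using Fin.induction with
        | zero => exact h0
        | succ i ih =>
          funext j
          have e1 := hs f i.castSucc j
          have e2 := hs g i.castSucc j
          rw [h1, ← e2, ih] at e1
          simpa using e1
    _ = Fintype.card F ^ (m+2) * Nat.card (MomSol F (m+2)) := by
        rw [Nat.card_prod]; simp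
    _ ≤ _ := Nat.mul_le_mul_left _ (card_momSol_le F (m+2) (by omega))

lemma le_card_hom (F : Type*) [Field F] [Fintype F] (d l : ℕ) (hd : 2 ≤ d) (hl : 2 ≤ l) :
    Fintype.card F ^ d * (Fintype.card F * (Fintype.card F - 1).descFactorial (l-1)) ≤
      Nat.card (cycleGraph l →g momGraph F d) := by
  classical
  obtain ⟨l, rfl⟩ := Nat.exists_eq_add_of_le' hl
  rw [Nat.card_congr (cycleHomEquiv _ l)]
  have hcard : Nat.card ((Fin d → F) × F × (Fin (l+1) ↪ Fˣ)) =
    Fintype.card F ^ d * (Fintype.card F * (Fintype.card F - 1).descFactorial (l+2-1)) := by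
    rw [Nat.card_prod, Nat.card_prod]
    simp [Nat.card_eq_fintype_card, Fintype.card_embedding_eq, Fintype.card_units]
  rw [← hcard]
  let c : (Fin (l+1) ↪ Fˣ) → Fin (l+2) → F := fun b => Fin.cons 0 (fun i => (b i : F))
  have hc : ∀ b, Function.Injective (c b) := by
    intro b
    refine Fin.cons_injective_iff.2 ⟨?_, ?_⟩
    · rintro ⟨i, hi⟩
      exact (b i).ne_zero hi
    · intro i j hij
      exact b.injective (Units.ext hij)
  let z : Fin d := ⟨0, by omega⟩
  let o : Fin d := ⟨1, by omega⟩
  let φ : (Fin d → F) × F × (Fin (l+1) ↪ Fˣ) → Fin (l+2) → (Fin d → F) :=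
    fun p i j => p.1 j + c p.2.2 i * p.2.1 ^ (j:ℕ)
  have hφ : ∀ p i, (momGraph F d).Adj (φ p i) (φ p (i+1)) := by
    intro p i
    refine ⟨fun h => ?_, p.2.1, c p.2.2 (i+1) - c p.2.2 i, fun j => ?_⟩
    · have := congrFun h z
      simp only [φ, z, pow_zero, mul_one, add_right_inj] at this
      have := hc _ this
      simp at this
    · simp only [φ]; ring
  refine Nat.card_le_card_of_injective (fun p => ⟨φ p, hφ p⟩) ?_
  rintro ⟨x, t, b⟩ ⟨x', t', b'⟩ h
  have h : φ (x,t,b) = φ (x',t',b') := congrArg Subtype.val h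
  have hx : x = x' := by
    funext j
    have := congrFun (congrFun h 0) j
    simpa [φ, c] using this
  subst hx
  have hb : b = b' := by
    ext i
    have := congrFun (congrFun h i.succ) z
    simpa [φ, c, z] using this
  subst hb
  have ht : t = t' := by
    have := congrFun (congrFun h (Fin.succ 0)) o
    simpa [φ, c, o] using this
  subst ht
  rfl

lemma homDensity_iso {α β γ : Type*} [Fintype α] [Fintype β] [Fintype γ] (G : SimpleGraph α)
    {T : SimpleGraph β} {T' : SimpleGraph γ} (e : T ≃g T') :
    homDensity G T = homDensity G T' := by
  have h : Nat.card (G →g T) = Nat.card (G →g T') := Nat.card_congr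
    { toFun := fun f => e.toHom.comp f
      invFun := fun f => e.symm.toHom.comp f
      left_inv := fun f => by ext; simp
      right_inv := fun f => by ext; simp }
  rw [homDensity, homDensity, h, Fintype.card_congr e.toEquiv]

lemma domSet_apply {α β V : Type*} [Fintype α] [Fintype β] [Fintype V] [Nonempty V]
    {G : SimpleGraph α} {H : SimpleGraph β} {c : ℝ} (hc : c ∈ domSet G H) (T : SimpleGraph V) :
    homDensity H T ^ c ≤ homDensity G T := by
  have e := SimpleGraph.Iso.comap (Fintype.equivFin V).symm T
  rw [← homDensity_iso G e, ← homDensity_iso H e]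
  exact hc.2 _ Fintype.card_pos _

lemma lower_bound (k l : ℕ) (hk : 2 ≤ k) (hl : 2 ≤ l) (c : ℝ)
    (hc : c ∈ domSet (cycleGraph (2*k)) (cycleGraph l)) :
    (4*(k:ℝ)*((k:ℝ)-1)) / (2*(k:ℝ)*(l:ℝ) - 2*(k:ℝ) - (l:ℝ)) ≤ c := by
  have hkR : (2:ℝ) ≤ k := by exact_mod_cast hk
  have hlR : (2:ℝ) ≤ l := by exact_mod_cast hl
  have hc0 := hc.1
  set E := 2*(k:ℝ)*(l:ℝ) - 2*(k:ℝ) - (l:ℝ) with hE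
  set D := 4*(k:ℝ)*((k:ℝ)-1) with hD
  have hEpos : 0 < E := by rw [hE]; nlinarith
  rw [div_le_iff₀ hEpos]
  by_contra! hlt
  set δ : ℝ := (1/2) ^ (l-1) with hδ
  have hδpos : 0 < δ := by positivity
  set B : ℝ := ((2*k : ℕ) : ℝ) ^ (2*k) with hB
  have key : ∀ q : ℕ, q.Prime → 2*l ≤ q → (q:ℝ) ^ (D - c*E) ≤ B / δ ^ c := by
    intro q hq hql
    have : Fact q.Prime := ⟨hq⟩
    have hqR : (0:ℝ) < q := by exact_mod_cast hq.pos
    have h := domSet_apply hc (momGraph (ZMod q) (2*k))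
    have hup := card_hom_le (ZMod q) (2*k) (by omega)
    have hlo := le_card_hom (ZMod q) (2*k) l (by omega) hl
    rw [ZMod.card] at hup hlo
    have hup' : homDensity (cycleGraph (2*k)) (momGraph (ZMod q) (2*k)) ≤ B * (q:ℝ) ^ (-D) := by
      unfold homDensity
      rw [div_le_iff₀ (by simp; positivity)]
      have h1 : (Nat.card (cycleGraph (2*k) →g momGraph (ZMod q) (2*k)) : ℝ) ≤
        (q:ℝ) ^ (2*k) * (B * (q:ℝ) ^ (2*k)) := by
        rw [hB]; exact_mod_cast hup
      refine h1.trans (le_of_eq ?_)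
      simp only [Fintype.card_pi, ZMod.card, Finset.prod_const, Finset.card_univ, Fintype.card_fin]
      push_cast
      rw [← pow_mul, ← Real.rpow_natCast, ← Real.rpow_natCast _ (2*k*(2*k))]
      calc (q:ℝ) ^ ((2*k:ℕ):ℝ) * (B * (q:ℝ) ^ ((2*k:ℕ):ℝ))
          = B * ((q:ℝ) ^ ((2*k:ℕ):ℝ) * (q:ℝ) ^ ((2*k:ℕ):ℝ)) := by ring
        _ = B * ((q:ℝ) ^ (-D) * (q:ℝ) ^ ((2*k*(2*k):ℕ):ℝ)) := by
          rw [← Real.rpow_add hqR, ← Real.rpow_add hqR]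
          congr 2
          rw [hD]; push_cast; ring
        _ = _ := by ring
    have hlo' : δ * (q:ℝ) ^ (-E) ≤ homDensity (cycleGraph l) (momGraph (ZMod q) (2*k)) := by
      unfold homDensity
      rw [le_div_iff₀ (by simp; positivity)]
      have h0 : ((q:ℝ)/2) ^ (l-1) ≤ ((q-1).descFactorial (l-1) : ℕ) := by
        have h2 := Nat.pow_sub_le_descFactorial (q-1) (l-1)
        calc ((q:ℝ)/2) ^ (l-1) ≤ ((q - 1 + 1 - (l-1) : ℕ) : ℝ) ^ (l-1) := by
              gcongr
              have : q ≤ 2 * (q - 1 + 1 - (l-1)) := by omega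
              have : (q:ℝ) ≤ 2 * ((q - 1 + 1 - (l-1) : ℕ):ℝ) := by exact_mod_cast this
              linarith
          _ ≤ _ := by exact_mod_cast h2
      have h1 : (q:ℝ) ^ (2*k) * (q * ((q:ℝ)/2) ^ (l-1)) ≤
        (Nat.card (cycleGraph l →g momGraph (ZMod q) (2*k)) : ℝ) := by
        calc _ ≤ (q:ℝ) ^ (2*k) * (q * (((q-1).descFactorial (l-1) : ℕ) : ℝ)) := by gcongr
          _ ≤ _ := by exact_mod_cast hlo
      refine le_trans (le_of_eq ?_) h1
      simp only [Fintype.card_pi, ZMod.card, Finset.prod_const, Finset.card_univ, Fintype.card_fin]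
      push_cast
      have h3 : (q:ℝ) * ((q:ℝ)/2) ^ (l-1) = δ * (q:ℝ) ^ l := by
        obtain ⟨l, rfl⟩ := Nat.exists_eq_add_of_le' hl
        rw [hδ, show l + 2 - 1 = l + 1 by omega, pow_succ (q:ℝ) (l+1), div_eq_mul_one_div, mul_pow]
        ring
      rw [h3, ← pow_mul, ← Real.rpow_natCast, ← Real.rpow_natCast _ (2*k), ← Real.rpow_natCast _ l]
      calc δ * (q:ℝ) ^ (-E) * (q:ℝ) ^ ((2*k*l:ℕ):ℝ)
          = δ * ((q:ℝ) ^ (-E) * (q:ℝ) ^ ((2*k*l:ℕ):ℝ)) := by ring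
        _ = δ * ((q:ℝ) ^ ((2*k:ℕ):ℝ) * (q:ℝ) ^ (l:ℝ)) := by
          rw [← Real.rpow_add hqR, ← Real.rpow_add hqR]
          congr 2
          rw [hE]; push_cast; ring
        _ = _ := by ring
    have h4 : (δ * (q:ℝ) ^ (-E)) ^ c ≤ B * (q:ℝ) ^ (-D) :=
      (Real.rpow_le_rpow (by positivity) hlo' hc0).trans (h.trans hup')
    rw [Real.mul_rpow hδpos.le (by positivity), ← Real.rpow_mul hqR.le] at h4
    rw [le_div_iff₀ (by positivity)]
    have h5 := mul_le_mul_of_nonneg_right h4 (Real.rpow_nonneg hqR.le D)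
    calc (q:ℝ) ^ (D - c*E) * δ ^ c = δ ^ c * ((q:ℝ) ^ (-E*c) * (q:ℝ) ^ D) := by
          rw [← Real.rpow_add hqR, mul_comm]
          congr 2; ring
      _ = δ ^ c * (q:ℝ) ^ (-E*c) * (q:ℝ) ^ D := by ring
      _ ≤ _ := h5
      _ = B * ((q:ℝ) ^ (-D) * (q:ℝ) ^ D) := by ring
      _ = B := by rw [← Real.rpow_add hqR]; simp
  have htend := (tendsto_rpow_atTop (sub_pos.2 hlt)).comp (tendsto_natCast_atTop_atTop (R := ℝ))
  obtain ⟨M, hM⟩ := Filter.eventually_atTop.1 (htend.eventually_gt_atTop (B / δ ^ c))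
  obtain ⟨q, hq1, hq2⟩ := Nat.exists_infinite_primes (max M (2*l))
  have := hM q (le_trans (le_max_left _ _) hq1)
  exact absurd (key q hq2 (le_trans (le_max_right _ _) hq1)) (not_le.2 this)

theorem stmt_7 (k l : ℕ) (hk : 2 ≤ k) (hl : 2 ≤ l) (hkl : l ≤ 2*k) :
    domExp (cycleGraph (2*k)) (cycleGraph l) =
      (4*(k:ℝ)*((k:ℝ)-1)) / (2*(k:ℝ)*(l:ℝ) - 2*(k:ℝ) - (l:ℝ)) := by
  exact IsLeast.csInf_eq ⟨upper_mem k l hk hl hkl, fun c hc => lower_bound k l hk hl c hc⟩
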